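/- Let I be an instance, e a non-leaf clean edge of I, and J a subinstance of I. Then: (1) if J lacks some covering fact of e in I, the weight of e in J is strictly less than the weight of e in I; (2) otherwise, the weight of e in J equals that in I, and if J moreover lacks some extra fact of e in I, then the extra weight of e in J is strictly less than the extra weight of e in I; (3) otherwise, the extra weight of e in J equals that in I, and if J moreover lacks some copy fact of e in I, then the lexicographic weight of e in J is strictly less than the lexicographic weight of e in I; (4) otherwise, the lexicographic weight of e in J equals that in I, and in fact J contains all incident facts of e in I. -/

import Mathlib

/- Formalization of instances over an arity-two relational signature,
homomorphisms, edges, dissociation, tightness, weights, etc. -/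

namespace UR

attribute [local instance] Classical.propDecidable

/-- A fact `R(a,b)` over signature `σ` with constants from `C`. -/
structure Fact (σ C : Type) where
  rel : σ
  fst : C
  snd : C

variable {σ C : Type}

/-- A fact uses a constant. -/
def Fact.uses (F : Fact σ C) (a : C) : Prop := F.fst = a ∨ F.snd = a

/-- An instance is a finite set of facts. -/
abbrev Instance (σ C : Type) := Finset (Fact σ C)

/-- Domain of an instance: constants occurring in its facts. -/
def dom (I : Instance σ C) : Set C := {a | ∃ F ∈ I, F.uses a}

/-- Applying a map of constants to a fact. -/
def mapFact (f : C → C) (F : Fact σ C) : Fact σ C := ⟨F.rel, f F.fst, f F.snd⟩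

/-- `h` is a homomorphism from `I` to `I'`. -/
def IsHom (h : C → C) (I I' : Instance σ C) : Prop := ∀ F ∈ I, mapFact h F ∈ I'

/-- A query is homomorphism-closed. -/
def HomClosed (Q : Instance σ C → Prop) : Prop :=
  ∀ (I I' : Instance σ C) (h : C → C), Q I → IsHom h I I' → Q I'

/-- Covering facts of the pair `(u,v)`: facts using both `u` and `v`. -/
noncomputable def covering (I : Instance σ C) (u v : C) : Instance σ C :=
  I.filter (fun F => F.uses u ∧ F.uses v)

/-- `(u,v)` is an edge of `I`. -/
def IsEdge (I : Instance σ C) (u v : C) : Prop := u ≠ v ∧ (covering I u v).Nonempty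

/-- Left-incident facts of `(u,v)`: facts using `u` but not `v`.
(The right-incident facts of `(u,v)` are `leftIncident I v u`.) -/
noncomputable def leftIncident (I : Instance σ C) (u v : C) : Instance σ C :=
  I.filter (fun F => F.uses u ∧ ¬ F.uses v)

/-- `(u,v)` is a non-leaf edge of `I`. -/
def IsNonLeafEdge (I : Instance σ C) (u v : C) : Prop :=
  IsEdge I u v ∧ (leftIncident I u v).Nonempty ∧ (leftIncident I v u).Nonempty

/-- The renaming sending `u` to `u'` and `v` to `v'`. -/
noncomputable def rename2 (u v u' v' : C) : C → C := fun a => if a = u then u' else if a = v then v' else a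

/-- The renaming sending `a` to `b`. -/
noncomputable def rename1 (a b : C) : C → C := fun x => if x = a then b else x

/-- Copying the edge `(u,v)` of `I` to the ordered pair `(u',v')`. -/
noncomputable def copyEdge (I : Instance σ C) (u v u' v' : C) : Instance σ C :=
  I ∪ (covering I u v).image (mapFact (rename2 u v u' v'))

/-- The dissociation of the non-leaf edge `(u,v)` in `I`, using fresh elements `u'` and `v'`:
copy `(u,v)` to `(u',v)` and to `(u,v')`, then remove the covering facts of `(u,v)`. -/
noncomputable def dissociation (I : Instance σ C) (u v u' v' : C) : Instance σ C :=
  (I ∪ (covering I u v).image (mapFact (rename2 u v u' v))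
     ∪ (covering I u v).image (mapFact (rename2 u v u v'))) \ covering I u v

/-- `(u,v)` is a tight edge of `I` for query `Q`: it is a non-leaf edge, `I` satisfies `Q`, and
the dissociation of `(u,v)` in `I` (with any choice of fresh elements) does not satisfy `Q`. -/
def IsTight (Q : Instance σ C → Prop) (I : Instance σ C) (u v : C) : Prop :=
  IsNonLeafEdge I u v ∧ Q I ∧
  ∀ u' v' : C, u' ∉ dom I → v' ∉ dom I → u' ≠ v' → ¬ Q (dissociation I u v u' v')

/-- The weight of an edge: number of covering facts. -/
noncomputable def weight (I : Instance σ C) (u v : C) : ℕ := (covering I u v).card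

/-- `I` is a subinstance-minimal model of `Q`. -/
def MinimalModel (Q : Instance σ C → Prop) (I : Instance σ C) : Prop :=
  Q I ∧ ∀ J : Instance σ C, J ⊂ I → ¬ Q J

/-- Two instances are isomorphic. -/
def IsIso (I J : Instance σ C) : Prop :=
  ∃ f : C → C, Function.Bijective f ∧ J = I.image (mapFact f)

/-- `Q` is unbounded: it has infinitely many subinstance-minimal models up to isomorphism,
i.e. no finite set of instances covers all its subinstance-minimal models up to isomorphism. -/
def Unbounded (Q : Instance σ C → Prop) : Prop :=
  ∀ S : Finset (Instance σ C), ∃ I, MinimalModel Q I ∧ ∀ J ∈ S, ¬ IsIso I J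

/-- The element `t` witnesses left garbage facts of the edge `(u,v)`: `(u,t)` is an edge whose
covering facts, renamed via `t ↦ v`, form a strict subset of the covering facts of `(u,v)`. -/
def HasLeftGarbage (I : Instance σ C) (u v t : C) : Prop :=
  t ≠ u ∧ t ≠ v ∧ IsEdge I u t ∧
    (covering I u t).image (mapFact (rename1 t v)) ⊂ covering I u v

/-- The element `w` witnesses right garbage facts of the edge `(u,v)`. -/
def HasRightGarbage (I : Instance σ C) (u v w : C) : Prop :=
  w ≠ u ∧ w ≠ v ∧ IsEdge I w v ∧
    (covering I w v).image (mapFact (rename1 w u)) ⊂ covering I u v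

/-- The edge `(u,v)` is clean: no left or right garbage facts. -/
def Clean (I : Instance σ C) (u v : C) : Prop :=
  (∀ t, ¬ HasLeftGarbage I u v t) ∧ (∀ w, ¬ HasRightGarbage I u v w)

/-- `F` is a left garbage fact of `(u,v)`. -/
def IsLeftGarbageFact (I : Instance σ C) (u v : C) (F : Fact σ C) : Prop :=
  ∃ t, HasLeftGarbage I u v t ∧ F ∈ covering I u t

/-- `F` is a right garbage fact of `(u,v)`. -/
def IsRightGarbageFact (I : Instance σ C) (u v : C) (F : Fact σ C) : Prop :=
  ∃ w, HasRightGarbage I u v w ∧ F ∈ covering I w v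

/-- `x` forms a triangle with the edge `(u,v)`. -/
def Triangle (I : Instance σ C) (u v x : C) : Prop := IsEdge I u x ∧ IsEdge I v x

/-- The edge `(u',v')` is a copy of the edge `(u,v)`: its covering facts are exactly the image
of the covering facts of `(u,v)` under the renaming `u ↦ u'`, `v ↦ v'`. -/
def IsCopy (I : Instance σ C) (u v u' v' : C) : Prop :=
  u' ≠ v' ∧ covering I u' v' = (covering I u v).image (mapFact (rename2 u v u' v'))

/-- `v'` is a left copy element of `(u,v)`. -/
def IsLeftCopyElem (I : Instance σ C) (u v v' : C) : Prop :=
  v' ≠ u ∧ v' ≠ v ∧ IsCopy I u v u v' ∧ ¬ Triangle I u v v'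

/-- `u'` is a right copy element of `(u,v)`. -/
def IsRightCopyElem (I : Instance σ C) (u v u' : C) : Prop :=
  u' ≠ u ∧ u' ≠ v ∧ IsCopy I u v u' v ∧ ¬ Triangle I u v u'

/-- `F` is a left copy fact of `(u,v)`. -/
def IsLeftCopyFact (I : Instance σ C) (u v : C) (F : Fact σ C) : Prop :=
  F ∈ leftIncident I u v ∧ ∃ v', IsLeftCopyElem I u v v' ∧ F.uses v'

/-- `F` is a right copy fact of `(u,v)`. -/
def IsRightCopyFact (I : Instance σ C) (u v : C) (F : Fact σ C) : Prop :=
  F ∈ leftIncident I v u ∧ ∃ u', IsRightCopyElem I u v u' ∧ F.uses u'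

/-- `F` is a left extra fact of `(u,v)`: a non-garbage left-incident fact which is unary on `u`,
or binary on `u` and an element `x` forming a triangle with `(u,v)` or such that the covering
facts of `(u,x)` are not isomorphic to those of `(u,v)`. -/
def IsLeftExtraFact (I : Instance σ C) (u v : C) (F : Fact σ C) : Prop :=
  F ∈ leftIncident I u v ∧ ¬ IsLeftGarbageFact I u v F ∧
    ((F.fst = u ∧ F.snd = u) ∨
      ∃ x, x ≠ u ∧ F.uses x ∧ (Triangle I u v x ∨ ¬ IsCopy I u v u x))

/-- `F` is a right extra fact of `(u,v)`. -/
def IsRightExtraFact (I : Instance σ C) (u v : C) (F : Fact σ C) : Prop :=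
  F ∈ leftIncident I v u ∧ ¬ IsRightGarbageFact I u v F ∧
    ((F.fst = v ∧ F.snd = v) ∨
      ∃ x, x ≠ v ∧ F.uses x ∧ (Triangle I u v x ∨ ¬ IsCopy I u v x v))

/-- The extra weight of `(u,v)`: number of extra facts. -/
noncomputable def extraWeight (I : Instance σ C) (u v : C) : ℕ :=
  (I.filter (fun F => IsLeftExtraFact I u v F ∨ IsRightExtraFact I u v F)).card

/-- The finite set of constants occurring in `I`. -/
noncomputable def constsOf (I : Instance σ C) : Finset C :=
  I.image Fact.fst ∪ I.image Fact.snd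

/-- The lexicographic weight of `(u,v)`: the pair (number of left copy elements,
number of right copy elements). -/
noncomputable def lexWeight (I : Instance σ C) (u v : C) : ℕ × ℕ :=
  (((constsOf I).filter (fun v' => IsLeftCopyElem I u v v')).card,
   ((constsOf I).filter (fun u' => IsRightCopyElem I u v u')).card)

/-- Lexicographic comparison of pairs of naturals. -/
def lexLt (p q : ℕ × ℕ) : Prop := p.1 < q.1 ∨ (p.1 = q.1 ∧ p.2 < q.2)

end UR

namespace UR

section Helpers

attribute [local instance] Classical.propDecidable

variable {σ C : Type}

theorem mem_cov {I : Instance σ C} {u v : C} {F : Fact σ C} :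
    F ∈ covering I u v ↔ F ∈ I ∧ F.uses u ∧ F.uses v := by
  simp [covering]

theorem mem_li {I : Instance σ C} {u v : C} {F : Fact σ C} :
    F ∈ leftIncident I u v ↔ F ∈ I ∧ F.uses u ∧ ¬ F.uses v := by
  simp [leftIncident]

theorem cov_comm (I : Instance σ C) (u v : C) : covering I u v = covering I v u := by
  ext F; simp only [mem_cov]; tauto

theorem isEdge_comm (I : Instance σ C) (u v : C) : IsEdge I u v ↔ IsEdge I v u := by
  unfold IsEdge; rw [cov_comm]; constructor <;> exact fun h => ⟨h.1.symm, h.2⟩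

theorem triangle_comm (I : Instance σ C) (u v x : C) : Triangle I u v x ↔ Triangle I v u x := by
  unfold Triangle; tauto

theorem isCopy_swap (I : Instance σ C) {u v : C} (huv : u ≠ v) (x : C) :
    IsCopy I u v x v ↔ IsCopy I v u v x := by
  have h : rename2 u v x v = rename2 v u v x := by
    funext a; unfold rename2; grind
  unfold IsCopy
  rw [h, cov_comm I u v, cov_comm I x v]
  constructor <;> exact fun h => ⟨h.1.symm, h.2⟩

theorem garb_swap (I : Instance σ C) (u v w : C) :
    HasRightGarbage I u v w ↔ HasLeftGarbage I v u w := by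
  unfold HasRightGarbage HasLeftGarbage
  rw [cov_comm I u v, cov_comm I w v, isEdge_comm I w v]; tauto

theorem garbF_swap (I : Instance σ C) (u v : C) (F : Fact σ C) :
    IsRightGarbageFact I u v F ↔ IsLeftGarbageFact I v u F := by
  unfold IsRightGarbageFact IsLeftGarbageFact
  simp only [garb_swap, cov_comm I v]

theorem copyElem_swap (I : Instance σ C) {u v : C} (huv : u ≠ v) (x : C) :
    IsRightCopyElem I u v x ↔ IsLeftCopyElem I v u x := by
  unfold IsRightCopyElem IsLeftCopyElem
  rw [isCopy_swap I huv, triangle_comm]; tauto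

theorem copyFact_swap (I : Instance σ C) {u v : C} (huv : u ≠ v) (F : Fact σ C) :
    IsRightCopyFact I u v F ↔ IsLeftCopyFact I v u F := by
  unfold IsRightCopyFact IsLeftCopyFact
  simp only [copyElem_swap I huv]

theorem extra_swap (I : Instance σ C) {u v : C} (huv : u ≠ v) (F : Fact σ C) :
    IsRightExtraFact I u v F ↔ IsLeftExtraFact I v u F := by
  unfold IsRightExtraFact IsLeftExtraFact
  simp only [isCopy_swap I huv, triangle_comm I u v, garbF_swap]

theorem cov_eq {I J : Instance σ C} (hJI : J ⊆ I) {u x : C} (h : covering I u x ⊆ J) :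
    covering J u x = covering I u x := by
  ext F; constructor
  · intro hF; rw [mem_cov] at *; exact ⟨hJI hF.1, hF.2⟩
  · intro hF; have := h hF; rw [mem_cov] at *; exact ⟨this, hF.2⟩

theorem edge_mono {I J : Instance σ C} (hJI : J ⊆ I) {u x : C} (h : IsEdge J u x) :
    IsEdge I u x := by
  obtain ⟨h, F, hF⟩ := h
  rw [mem_cov] at hF
  exact ⟨h, F, mem_cov.2 ⟨hJI hF.1, hF.2⟩⟩

theorem tri_mono {I J : Instance σ C} (hJI : J ⊆ I) {u v x : C} (h : Triangle J u v x) :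
    Triangle I u v x := ⟨edge_mono hJI h.1, edge_mono hJI h.2⟩

theorem uses_two {F : Fact σ C} {u x y : C} (hx : x ≠ u) (hy : y ≠ u)
    (h0 : F.uses u) (h1 : F.uses x) (h2 : F.uses y) : x = y := by
  unfold Fact.uses at *; grind

theorem map_back {I : Instance σ C} {u v x : C} (huv : u ≠ v) (hx : x ≠ u)
    {F : Fact σ C} (hF : F ∈ covering I u v) :
    mapFact (rename1 x v) (mapFact (rename2 u v u x) F) = F := by
  rw [mem_cov] at hF
  obtain ⟨-, h1, h2⟩ := hF
  obtain ⟨r, a, b⟩ := F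
  simp only [Fact.uses, mapFact, rename1, rename2] at *
  grind

theorem garbage_of_lost {I J : Instance σ C} (hJI : J ⊆ I) {u v x : C} (huv : u ≠ v)
    (hC : covering I u v ⊆ J) (hxu : x ≠ u) (hxv : x ≠ v)
    (hcI : IsCopy I u v u x) (hcJ : ¬ IsCopy J u v u x) (he : IsEdge J u x) :
    HasLeftGarbage J u v x := by
  have hCe := cov_eq hJI hC
  refine ⟨hxu, hxv, he, ?_⟩
  rw [hCe, Finset.ssubset_iff_subset_ne]
  have key : ∀ G ∈ covering J u x, ∃ F ∈ covering I u v, mapFact (rename2 u v u x) F = G := by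
    intro G hG
    have : G ∈ covering I u x := by
      rw [mem_cov] at *; exact ⟨hJI hG.1, hG.2⟩
    rw [hcI.2] at this
    simpa using this
  constructor
  · intro F hF
    obtain ⟨G, hG, rfl⟩ := Finset.mem_image.1 hF
    obtain ⟨F, hF1, rfl⟩ := key G hG
    rwa [map_back huv hxu hF1]
  · intro heq
    apply hcJ
    refine ⟨hxu.symm, ?_⟩
    rw [hCe]
    ext G; constructor
    · intro hG
      obtain ⟨F, hF, rfl⟩ := key G hG
      exact Finset.mem_image_of_mem _ hF
    · intro hG
      obtain ⟨F, hF, rfl⟩ := Finset.mem_image.1 hG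
      have hF' := hF
      rw [← heq] at hF'
      obtain ⟨G, hG1, hGF⟩ := Finset.mem_image.1 hF'
      obtain ⟨F', hF'', rfl⟩ := key G hG1
      rw [map_back huv hxu hF''] at hGF
      subst hGF
      exact hG1

theorem clean_fact {I : Instance σ C} {u v : C} (hcl : ∀ t, ¬ HasLeftGarbage I u v t)
    (F : Fact σ C) : ¬ IsLeftGarbageFact I u v F := fun ⟨t, h, _⟩ => hcl t h

theorem extra_sub {I J : Instance σ C} (hJI : J ⊆ I) {u v : C} (huv : u ≠ v)
    (hC : covering I u v ⊆ J) (hcl : ∀ t, ¬ HasLeftGarbage I u v t)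
    {F : Fact σ C} (hF : IsLeftExtraFact J u v F) : IsLeftExtraFact I u v F := by
  obtain ⟨hl, hg, h⟩ := hF
  rw [mem_li] at hl
  refine ⟨mem_li.2 ⟨hJI hl.1, hl.2⟩, clean_fact hcl F, ?_⟩
  refine h.imp id ?_
  rintro ⟨x, hxu, hFx, h⟩
  refine ⟨x, hxu, hFx, ?_⟩
  rcases h with h | h
  · exact Or.inl (tri_mono hJI h)
  · right
    intro hc
    have hFc : F ∈ covering J u x := mem_cov.2 ⟨hl.1, hl.2.1, hFx⟩
    have hxv : x ≠ v := by rintro rfl; exact hl.2.2 hFx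
    exact hg ⟨x, garbage_of_lost hJI huv hC hxu hxv hc h ⟨hxu.symm, F, hFc⟩, hFc⟩

theorem not_uses_third {F : Fact σ C} {u v x : C} (hxu : x ≠ u) (hxv : x ≠ v) (huv : u ≠ v)
    (h0 : F.uses u) (h1 : F.uses x) : ¬ F.uses v := by
  unfold Fact.uses at *; grind

theorem cov_sub_of_ex {I J : Instance σ C} {u v : C} (huv : u ≠ v)
    (hcl : ∀ t, ¬ HasLeftGarbage I u v t)
    (hE : ∀ F ∈ I, IsLeftExtraFact I u v F → F ∈ J) {x : C} (hxu : x ≠ u) (hxv : x ≠ v)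
    (h : Triangle I u v x ∨ ¬ IsCopy I u v u x) : covering I u x ⊆ J := by
  intro F hF
  rw [mem_cov] at hF
  exact hE F hF.1 ⟨mem_li.2 ⟨hF.1, hF.2.1, not_uses_third hxu hxv huv hF.2.1 hF.2.2⟩,
    clean_fact hcl F, Or.inr ⟨x, hxu, hF.2.2, h⟩⟩

theorem tri_keep {I J : Instance σ C} (hJI : J ⊆ I) {u v : C} (huv : u ≠ v)
    (hcl : ∀ t, ¬ HasLeftGarbage I u v t) (hcl' : ∀ t, ¬ HasLeftGarbage I v u t)
    (hE : ∀ F ∈ I, IsLeftExtraFact I u v F → F ∈ J)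
    (hE' : ∀ F ∈ I, IsLeftExtraFact I v u F → F ∈ J) {x : C}
    (h : Triangle I u v x) : Triangle J u v x := by
  have hxu := h.1.1.symm
  have hxv := h.2.1.symm
  have h1 := cov_eq hJI (cov_sub_of_ex huv hcl hE hxu hxv (Or.inl h))
  have h2 := cov_eq hJI
    (cov_sub_of_ex huv.symm hcl' hE' hxv hxu (Or.inl ((triangle_comm _ _ _ _).1 h)))
  refine ⟨⟨h.1.1, ?_⟩, ⟨h.2.1, ?_⟩⟩
  · rw [h1]; exact h.1.2
  · rw [h2]; exact h.2.2

theorem isCopy_congr {I J : Instance σ C} {u v x : C} (h : covering J u v = covering I u v)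
    (h' : covering J u x = covering I u x) : IsCopy J u v u x ↔ IsCopy I u v u x := by
  unfold IsCopy; rw [h, h']

theorem extra_keep {I J : Instance σ C} (hJI : J ⊆ I) {u v : C} (huv : u ≠ v)
    (hC : covering I u v ⊆ J)
    (hcl : ∀ t, ¬ HasLeftGarbage I u v t) (hcl' : ∀ t, ¬ HasLeftGarbage I v u t)
    (hE : ∀ F ∈ I, IsLeftExtraFact I u v F → F ∈ J)
    (hE' : ∀ F ∈ I, IsLeftExtraFact I v u F → F ∈ J)
    {F : Fact σ C} (hF : IsLeftExtraFact I u v F) : IsLeftExtraFact J u v F := by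
  have hCe := cov_eq hJI hC
  have hFI := (mem_li.1 hF.1).1
  have hFJ := hE F hFI hF
  obtain ⟨hl, hg, h⟩ := hF
  rw [mem_li] at hl
  refine ⟨mem_li.2 ⟨hFJ, hl.2⟩, ?_, ?_⟩
  · rintro ⟨t, ht, hFt⟩
    rw [mem_cov] at hFt
    rcases h with h | ⟨x, hxu, hFx, h⟩
    · have := ht.1
      have h3 := hFt.2.2
      unfold Fact.uses at h3
      grind
    · obtain rfl := uses_two hxu ht.1 hl.2.1 hFx hFt.2.2
      have he := cov_eq hJI (cov_sub_of_ex huv hcl hE hxu ht.2.1 h)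
      apply hcl x
      have hs := ht.2.2.2
      rw [hCe, he] at hs
      exact ⟨hxu, ht.2.1, edge_mono hJI ht.2.2.1, hs⟩
  · refine h.imp id ?_
    rintro ⟨x, hxu, hFx, h⟩
    have hxv : x ≠ v := by rintro rfl; exact hl.2.2 hFx
    refine ⟨x, hxu, hFx, ?_⟩
    have he := cov_eq hJI (cov_sub_of_ex huv hcl hE hxu hxv h)
    rw [isCopy_congr hCe he]
    exact h.imp (tri_keep hJI huv hcl hcl' hE hE') id

theorem copyElem_sub {I J : Instance σ C} (hJI : J ⊆ I) {u v : C} (huv : u ≠ v)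
    (hC : covering I u v ⊆ J)
    (hcl : ∀ t, ¬ HasLeftGarbage I u v t) (hcl' : ∀ t, ¬ HasLeftGarbage I v u t)
    (hE : ∀ F ∈ I, IsLeftExtraFact I u v F → F ∈ J)
    (hE' : ∀ F ∈ I, IsLeftExtraFact I v u F → F ∈ J)
    {x : C} (hx : IsLeftCopyElem J u v x) : IsLeftCopyElem I u v x := by
  obtain ⟨hxu, hxv, hc, ht⟩ := hx
  refine ⟨hxu, hxv, ?_, fun h => ht (tri_keep hJI huv hcl hcl' hE hE' h)⟩
  by_contra hn
  have he := cov_eq hJI (cov_sub_of_ex huv hcl hE hxu hxv (Or.inr hn))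
  exact hn ((isCopy_congr (cov_eq hJI hC) he).1 hc)

theorem mem_consts {I : Instance σ C} {x : C} : x ∈ constsOf I ↔ ∃ F ∈ I, F.uses x := by
  unfold constsOf Fact.uses; simp only [Finset.mem_union, Finset.mem_image]
  constructor
  · rintro (⟨F, h, h'⟩ | ⟨F, h, h'⟩)
    exacts [⟨F, h, Or.inl h'⟩, ⟨F, h, Or.inr h'⟩]
  · rintro ⟨F, h, h' | h'⟩
    exacts [Or.inl ⟨F, h, h'⟩, Or.inr ⟨F, h, h'⟩]

/-- The finite set of left copy elements. -/
noncomputable def lce (I : Instance σ C) (u v : C) : Finset C :=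
  (constsOf I).filter (fun v' => IsLeftCopyElem I u v v')

theorem mem_lce {I : Instance σ C} {u v x : C} :
    x ∈ lce I u v ↔ x ∈ constsOf I ∧ IsLeftCopyElem I u v x := by simp [lce]

theorem lce_sub {I J : Instance σ C} (hJI : J ⊆ I) {u v : C} (huv : u ≠ v)
    (hC : covering I u v ⊆ J)
    (hcl : ∀ t, ¬ HasLeftGarbage I u v t) (hcl' : ∀ t, ¬ HasLeftGarbage I v u t)
    (hE : ∀ F ∈ I, IsLeftExtraFact I u v F → F ∈ J)
    (hE' : ∀ F ∈ I, IsLeftExtraFact I v u F → F ∈ J) : lce J u v ⊆ lce I u v := by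
  intro x hx
  rw [mem_lce, mem_consts] at *
  obtain ⟨⟨F, hF, h⟩, h'⟩ := hx
  exact ⟨⟨F, hJI hF, h⟩, copyElem_sub hJI huv hC hcl hcl' hE hE' h'⟩

theorem lce_lt {I J : Instance σ C} (hJI : J ⊆ I) {u v : C} (huv : u ≠ v)
    (hC : covering I u v ⊆ J)
    (hcl : ∀ t, ¬ HasLeftGarbage I u v t) (hcl' : ∀ t, ¬ HasLeftGarbage I v u t)
    (hE : ∀ F ∈ I, IsLeftExtraFact I u v F → F ∈ J)
    (hE' : ∀ F ∈ I, IsLeftExtraFact I v u F → F ∈ J)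
    {F : Fact σ C} (hF : IsLeftCopyFact I u v F) (hFJ : F ∉ J) :
    (lce J u v).card < (lce I u v).card := by
  apply Finset.card_lt_card
  rw [Finset.ssubset_iff_of_subset (lce_sub hJI huv hC hcl hcl' hE hE')]
  obtain ⟨hl, x, hx, hFx⟩ := hF
  rw [mem_li] at hl
  refine ⟨x, mem_lce.2 ⟨mem_consts.2 ⟨F, hl.1, hFx⟩, hx⟩, ?_⟩
  intro hxJ
  have h1 := (mem_lce.1 hxJ).2.2.2.1.2
  have h2 := hx.2.2.1.2
  rw [cov_eq hJI hC, ← h2] at h1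
  have : F ∈ covering I u x := mem_cov.2 ⟨hl.1, hl.2.1, hFx⟩
  rw [← h1] at this
  exact hFJ (mem_cov.1 this).1

theorem lce_eq {I J : Instance σ C} (hJI : J ⊆ I) {u v : C} (huv : u ≠ v)
    (hC : covering I u v ⊆ J)
    (hcl : ∀ t, ¬ HasLeftGarbage I u v t) (hcl' : ∀ t, ¬ HasLeftGarbage I v u t)
    (hE : ∀ F ∈ I, IsLeftExtraFact I u v F → F ∈ J)
    (hE' : ∀ F ∈ I, IsLeftExtraFact I v u F → F ∈ J)
    (hne : (covering I u v).Nonempty)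
    (hK : ∀ F ∈ I, IsLeftCopyFact I u v F → F ∈ J) :
    lce J u v = lce I u v := by
  apply (lce_sub hJI huv hC hcl hcl' hE hE').antisymm
  intro x hx
  have hx := (mem_lce.1 hx).2
  obtain ⟨hxu, hxv, hc, ht⟩ := id hx
  have hs : covering I u x ⊆ J := by
    intro F hF
    rw [mem_cov] at hF
    exact hK F hF.1 ⟨mem_li.2 ⟨hF.1, hF.2.1, not_uses_third hxu hxv huv hF.2.1 hF.2.2⟩,
      x, hx, hF.2.2⟩
  have he := cov_eq hJI hs
  have hn : (covering I u x).Nonempty := by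
    rw [hc.2]; exact hne.image _
  obtain ⟨F, hF⟩ := hn
  exact mem_lce.2 ⟨mem_consts.2 ⟨F, hs hF, (mem_cov.1 hF).2.2⟩, hxu, hxv,
    (isCopy_congr (cov_eq hJI hC) he).2 hc, fun h => ht (tri_mono hJI h)⟩

theorem incident_mem {I J : Instance σ C} {u v : C}
    (hcl : ∀ t, ¬ HasLeftGarbage I u v t)
    (hE : ∀ F ∈ I, IsLeftExtraFact I u v F → F ∈ J)
    (hK : ∀ F ∈ I, IsLeftCopyFact I u v F → F ∈ J)
    {F : Fact σ C} (hF : F ∈ leftIncident I u v) : F ∈ J := by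
  have hl := mem_li.1 hF
  by_cases hu : F.fst = u ∧ F.snd = u
  · exact hE F hl.1 ⟨hF, clean_fact hcl F, Or.inl hu⟩
  · obtain ⟨x, hxu, hFx⟩ : ∃ x, x ≠ u ∧ F.uses x := by
      by_cases h : F.fst = u
      · exact ⟨F.snd, fun h' => hu ⟨h, h'⟩, Or.inr rfl⟩
      · exact ⟨F.fst, h, Or.inl rfl⟩
    have hxv : x ≠ v := by rintro rfl; exact hl.2.2 hFx
    by_cases h : Triangle I u v x ∨ ¬ IsCopy I u v u x
    · exact hE F hl.1 ⟨hF, clean_fact hcl F, Or.inr ⟨x, hxu, hFx, h⟩⟩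
    · push Not at h
      exact hK F hl.1 ⟨hF, x, ⟨hxu, hxv, h.2, h.1⟩, hFx⟩

theorem lexWeight_eq (I : Instance σ C) {u v : C} (huv : u ≠ v) :
    lexWeight I u v = ((lce I u v).card, (lce I v u).card) := by
  unfold lexWeight lce
  simp only [copyElem_swap I huv]

/-- The finite set of extra facts. -/
noncomputable def exf (I : Instance σ C) (u v : C) : Instance σ C :=
  I.filter (fun F => IsLeftExtraFact I u v F ∨ IsRightExtraFact I u v F)

theorem mem_exf {I : Instance σ C} {u v : C} (huv : u ≠ v) {F : Fact σ C} : F ∈ exf I u v ↔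
    F ∈ I ∧ (IsLeftExtraFact I u v F ∨ IsLeftExtraFact I v u F) := by
  simp [exf, extra_swap I huv]

theorem extraWeight_eq (I : Instance σ C) (u v : C) :
    extraWeight I u v = (exf I u v).card := rfl

end Helpers


/-- let `I` be an instance, `(u,v)` a non-leaf clean edge of `I`, and `J` a
subinstance of `I`. Then: (1) if `J` lacks some covering fact of `(u,v)` in `I`, the weight in
`J` is strictly smaller; (2) otherwise the weight is the same, and if `J` lacks some extra
fact, the extra weight in `J` is strictly smaller; (3) otherwise the extra weight is the same,
and if `J` lacks some copy fact, the lexicographic weight in `J` is strictly smaller; (4)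
otherwise the lexicographic weight is the same and `J` contains all incident facts of `(u,v)`
in `I`. -/
theorem subinstance_weight_trichotomy {σ C : Type} (I J : Instance σ C) (hJI : J ⊆ I)
    (u v : C) (hnl : IsNonLeafEdge I u v) (hclean : Clean I u v) :
    (¬ covering I u v ⊆ J → weight J u v < weight I u v) ∧
    (covering I u v ⊆ J →
      weight J u v = weight I u v ∧
      ((∃ F ∈ I, (IsLeftExtraFact I u v F ∨ IsRightExtraFact I u v F) ∧ F ∉ J) →
        extraWeight J u v < extraWeight I u v) ∧
      ((∀ F ∈ I, (IsLeftExtraFact I u v F ∨ IsRightExtraFact I u v F) → F ∈ J) →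
        extraWeight J u v = extraWeight I u v ∧
        ((∃ F ∈ I, (IsLeftCopyFact I u v F ∨ IsRightCopyFact I u v F) ∧ F ∉ J) →
          lexLt (lexWeight J u v) (lexWeight I u v)) ∧
        ((∀ F ∈ I, (IsLeftCopyFact I u v F ∨ IsRightCopyFact I u v F) → F ∈ J) →
          lexWeight J u v = lexWeight I u v ∧
          ∀ F, F ∈ leftIncident I u v ∨ F ∈ leftIncident I v u → F ∈ J))) := by
  have huv := hnl.1.1
  have hne := hnl.1.2
  have hcl : ∀ t, ¬ HasLeftGarbage I u v t := hclean.1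
  have hcl' : ∀ t, ¬ HasLeftGarbage I v u t := fun t h => hclean.2 t ((garb_swap I u v t).2 h)
  simp only [lexWeight_eq _ huv, extra_swap _ huv, copyFact_swap _ huv]
  simp only [extraWeight_eq]
  unfold weight
  refine ⟨?_, ?_⟩
  · intro h
    obtain ⟨F, hF, hFJ⟩ := Finset.not_subset.1 h
    apply Finset.card_lt_card
    rw [Finset.ssubset_iff_of_subset]
    · exact ⟨F, hF, fun h => hFJ (mem_cov.1 h).1⟩
    · intro G hG
      rw [mem_cov] at *
      exact ⟨hJI hG.1, hG.2⟩
  intro hC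
  have hC' : covering I v u ⊆ J := by rwa [cov_comm]
  have hne' : (covering I v u).Nonempty := by rwa [cov_comm]
  have hsub : exf J u v ⊆ exf I u v := by
    intro F hF
    rw [mem_exf huv] at *
    exact ⟨hJI hF.1, hF.2.imp (extra_sub hJI huv hC hcl) (extra_sub hJI huv.symm hC' hcl')⟩
  refine ⟨by rw [cov_eq hJI hC], ?_, ?_⟩
  · rintro ⟨F, hF, hx, hFJ⟩
    apply Finset.card_lt_card
    rw [Finset.ssubset_iff_of_subset hsub]
    exact ⟨F, (mem_exf huv).2 ⟨hF, hx⟩, fun h => hFJ ((mem_exf huv).1 h).1⟩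
  intro hE0
  have hE : ∀ F ∈ I, IsLeftExtraFact I u v F → F ∈ J := fun F h h' => hE0 F h (Or.inl h')
  have hE' : ∀ F ∈ I, IsLeftExtraFact I v u F → F ∈ J := fun F h h' => hE0 F h (Or.inr h')
  refine ⟨?_, ?_, ?_⟩
  · congr 1
    apply hsub.antisymm
    intro F hF
    rw [mem_exf huv] at *
    exact ⟨hE0 F hF.1 hF.2, hF.2.imp (extra_keep hJI huv hC hcl hcl' hE hE')
      (extra_keep hJI huv.symm hC' hcl' hcl hE' hE)⟩
  · rintro ⟨F, hF, hx, hFJ⟩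
    have l1 := Finset.card_le_card (lce_sub hJI huv hC hcl hcl' hE hE')
    unfold lexLt
    rcases hx with hx | hx
    · exact Or.inl (lce_lt hJI huv hC hcl hcl' hE hE' hx hFJ)
    · have l2 := lce_lt hJI huv.symm hC' hcl' hcl hE' hE hx hFJ
      rcases l1.lt_or_eq with l | l
      · exact Or.inl l
      · exact Or.inr ⟨l, l2⟩
  · intro hK0
    have hK : ∀ F ∈ I, IsLeftCopyFact I u v F → F ∈ J := fun F h h' => hK0 F h (Or.inl h')
    have hK' : ∀ F ∈ I, IsLeftCopyFact I v u F → F ∈ J := fun F h h' => hK0 F h (Or.inr h')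
    refine ⟨?_, ?_⟩
    · rw [lce_eq hJI huv hC hcl hcl' hE hE' hne hK,
        lce_eq hJI huv.symm hC' hcl' hcl hE' hE hne' hK']
    · rintro F (h | h)
      · exact incident_mem hcl hE hK h
      · exact incident_mem hcl' hE' hK' h

end UR
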